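/- arXiv:2407.20953 — 2 statements merged into one kernel-verified Lean document; each statement's English description precedes it below -/
import Mathlib

section
/- Monotonicity of the partial order on φ(V_D) (Corollary 2.5): if A', A ∈ φ(V_D) satisfy A' ≤ A, then |A'| ≤ |A|. -/
open scoped BigOperators

/-- `W D` : functions `Z/(D+1) → F₂`. -/
abbrev Wsp (D : ℕ) : Type := ZMod (D + 1) → ZMod 2

/-- The all-ones function. -/
def allOnes (D : ℕ) : Wsp D := fun _ => 1

/-- `V D = W/span{u}`. -/
abbrev Vsp (D : ℕ) : Type := Wsp D ⧸ Submodule.span (ZMod 2) {allOnes D}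

/-- `e i` : image of the standard basis function at `i`. -/
def eV (D : ℕ) (i : ZMod (D + 1)) : Vsp D :=
  Submodule.Quotient.mk (Pi.single i 1)

/-- `e_I = ∑_{s ∈ I} e_s`. -/
def eSet (D : ℕ) (I : Finset (ZMod (D + 1))) : Vsp D := ∑ s ∈ I, eV D s

/-- A cyclic interval (arc): nonempty proper subset of the form `{i, i+1, …, j}`. -/
def IsInterval (D : ℕ) (I : Finset (ZMod (D + 1))) : Prop :=
  ∃ (i : ZMod (D + 1)) (l : ℕ), 1 ≤ l ∧ l ≤ D ∧
    I = (Finset.range l).image (fun t : ℕ => i + (t : ZMod (D + 1)))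

/-- Member of `ℐ¹` : interval of odd cardinality. -/
def OddInterval (D : ℕ) (I : Finset (ZMod (D + 1))) : Prop :=
  IsInterval D I ∧ Odd I.card

/-- `I ≺ I'` : `I ⊊ I'` and `I' − I` is a disjoint union of two intervals. -/
def Prec (D : ℕ) (I I' : Finset (ZMod (D + 1))) : Prop :=
  I ⊂ I' ∧ ∃ I₁ I₂, IsInterval D I₁ ∧ IsInterval D I₂ ∧ Disjoint I₁ I₂ ∧ I' \ I = I₁ ∪ I₂

/-- `I ♠ I'` : `I ∩ I' = ∅` and `I ∪ I'` is not an interval. -/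
def Spade (D : ℕ) (I I' : Finset (ZMod (D + 1))) : Prop :=
  I ∩ I' = ∅ ∧ ¬ IsInterval D (I ∪ I')

/-- `I^ev`. -/
noncomputable def evSet (D : ℕ) (I : Finset (ZMod (D + 1))) : Finset (ZMod (D + 1)) :=
  @Finset.filter _
    (fun i => ∃ I' I'', OddInterval D I' ∧ OddInterval D I'' ∧ Spade D I' I'' ∧
      I.erase i = I' ∪ I'')
    (Classical.decPred _) I

/-- `B ∈ φ(V_D)` : a finite set of elements of `ℐ¹` satisfying (P0) and (P1). -/
def phi (D : ℕ) (B : Finset (Finset (ZMod (D + 1)))) : Prop :=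
  (∀ I ∈ B, OddInterval D I) ∧
  (∀ I ∈ B, ∀ I' ∈ B, I = I' ∨ Spade D I I' ∨ Prec D I I' ∨ Prec D I' I) ∧
  (∀ I ∈ B, ∃ 𝒥 : Finset (Finset (ZMod (D + 1))), 𝒥 ⊆ B ∧
    (∀ J ∈ 𝒥, Prec D J I) ∧
    (∀ J ∈ 𝒥, ∀ J' ∈ 𝒥, J ≠ J' → Disjoint J J') ∧
    evSet D I ⊆ 𝒥.biUnion id)

/-- `⟨B⟩` : the F₂-span of `{e_I : I ∈ B}`. -/
def spanB (D : ℕ) (B : Finset (Finset (ZMod (D + 1)))) : Submodule (ZMod 2) (Vsp D) :=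
  Submodule.span (ZMod 2) (eSet D '' ↑B)

/-- `g_i(B) = |{I ∈ B : i ∈ I}|`. -/
def gB (D : ℕ) (B : Finset (Finset (ZMod (D + 1)))) (i : ZMod (D + 1)) : ℕ :=
  (B.filter (fun I => i ∈ I)).card

/-- `ε(B) = ∑_i (g_i(B)(g_i(B)+1)/2 mod 2) e_i`. -/
def epsB (D : ℕ) (B : Finset (Finset (ZMod (D + 1)))) : Vsp D :=
  ∑ i : ZMod (D + 1), ((gB D B i * (gB D B i + 1) / 2 : ℕ) : ZMod 2) • eV D i

/-- The partial order `B' ≤ B` on `φ(V_D)`. -/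
def leφ (D : ℕ) (B' B : Finset (Finset (ZMod (D + 1)))) : Prop :=
  ∃ (k : ℕ) (c : ℕ → Finset (Finset (ZMod (D + 1)))),
    c 0 = B' ∧ c k = B ∧ (∀ s ≤ k, phi D (c s)) ∧
    ∀ s < k, epsB D (c s) ∈ spanB D (c (s + 1))

/-- `B' < B`. -/
def ltφ (D : ℕ) (B' B : Finset (Finset (ZMod (D + 1)))) : Prop :=
  leφ D B' B ∧ B' ≠ B

/-- `1_E ∈ ℂ[V_D]`, the indicator function of `E ⊆ V_D`. -/
noncomputable def ind (D : ℕ) (E : Set (Vsp D)) : Vsp D → ℂ := E.indicator 1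

/-- `δ_x ∈ ℂ[V_D]`. -/
noncomputable def delta (D : ℕ) (x : Vsp D) : Vsp D → ℂ := ind D {x}

/-- The symplectic form on `W`. -/
def formW (D : ℕ) (x y : Wsp D) : ZMod 2 :=
  ∑ i : ZMod (D + 1), (x i * y (i + 1) + x (i + 1) * y i)

/-- The induced symplectic form on `V_D` (well defined since the form kills `u`). -/
noncomputable def formV (D : ℕ) (x y : Vsp D) : ZMod 2 :=
  formW D (Quotient.out x) (Quotient.out y)

/-- The Fourier transform `ℂ[V_D] → ℂ[V_D]`. -/
noncomputable def fourierV (D : ℕ) (f : Vsp D → ℂ) : Vsp D → ℂ :=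
  fun y => (2 : ℂ) ^ (-((D / 2 : ℕ) : ℤ)) *
    ∑ᶠ x : Vsp D, (if formV D x y = 0 then (1 : ℂ) else -1) * f x

/-- The target in `V_D` of the basis vector `e'_ℓ` of `V_{D-2}` under `τ_j`. -/
noncomputable def tauTgt (D j : ℕ) (ℓ : ZMod (D - 2 + 1)) : Vsp D :=
  let L : ℕ := if ℓ.val = 0 then D - 1 else ℓ.val
  if ℓ = ((j - 1 : ℕ) : ZMod (D - 2 + 1)) then
    eV D ((j : ZMod (D + 1)) - 1) + eV D (j : ZMod (D + 1)) + eV D ((j : ZMod (D + 1)) + 1)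
  else if L < j - 1 then eV D (L : ZMod (D + 1))
  else eV D ((L + 2 : ℕ) : ZMod (D + 1))

/-- The linear embedding `τ_j : V_{D-2} → V_D` (well defined independently of the chosen
representative since the targets sum to `0`). -/
noncomputable def tauMap (D j : ℕ) (x : Vsp (D - 2)) : Vsp D :=
  ∑ i : ZMod (D - 2 + 1), (Quotient.out x) i • tauTgt D j i

namespace CyclicArc

variable {D : ℕ}

/-- The arc `{a, a+1, …, a+l-1}` of `Z/(D+1)`. -/
def arc (D : ℕ) (a : ZMod (D + 1)) (l : ℕ) : Finset (ZMod (D + 1)) :=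
  (Finset.range l).image (fun t : ℕ => a + (t : ZMod (D + 1)))

lemma mem_arc {a i : ZMod (D + 1)} {l : ℕ} (hl : l ≤ D + 1) :
    i ∈ arc D a l ↔ (i - a).val < l := by
  simp only [arc, Finset.mem_image, Finset.mem_range]
  constructor
  · rintro ⟨t, ht, rfl⟩
    rw [add_sub_cancel_left, ZMod.val_natCast_of_lt (by omega)]
    exact ht
  · intro h
    exact ⟨(i - a).val, h, by simp⟩

lemma val_sub_eq {a i : ZMod (D + 1)} {t : ℕ} (ht : t ≤ D) :
    (i - a).val = t ↔ i = a + (t : ZMod (D + 1)) := by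
  constructor
  · rintro rfl
    simp
  · rintro rfl
    rw [add_sub_cancel_left, ZMod.val_natCast_of_lt (by omega)]

lemma card_arc {a : ZMod (D + 1)} {l : ℕ} (hl : l ≤ D + 1) : (arc D a l).card = l := by
  rw [arc, Finset.card_image_of_injOn, Finset.card_range]
  intro s hs t ht h
  simp only [Finset.coe_range, Set.mem_Iio] at hs ht
  have := congrArg ZMod.val (add_left_cancel h)
  rwa [ZMod.val_natCast_of_lt (by omega), ZMod.val_natCast_of_lt (by omega)] at this

lemma isInterval_iff {I : Finset (ZMod (D + 1))} :
    IsInterval D I ↔ ∃ a l, 1 ≤ l ∧ l ≤ D ∧ I = arc D a l := Iff.rfl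

lemma OddInterval.exists_arc {I : Finset (ZMod (D + 1))} (h : OddInterval D I) :
    ∃ a l, Odd l ∧ l ≤ D ∧ I = arc D a l := by
  obtain ⟨⟨a, l, h1, h2, h3⟩, ho⟩ := h
  change I = arc D a l at h3
  subst h3
  rw [card_arc (by omega)] at ho
  exact ⟨a, l, ho, h2, rfl⟩

lemma oddInterval_arc {a : ZMod (D + 1)} {l : ℕ} (ho : Odd l) (hl : l ≤ D) :
    OddInterval D (arc D a l) :=
  ⟨⟨a, l, ho.pos, hl, rfl⟩, by rwa [card_arc (by omega)]⟩

lemma val_succ_sub {a i : ZMod (D + 1)} :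
    ((i - a).val < D ∧ (i + 1 - a).val = (i - a).val + 1) ∨
      ((i - a).val = D ∧ (i + 1 - a).val = 0) := by
  have hlt := ZMod.val_lt (i - a)
  have hi : i + 1 - a = (((i - a).val + 1 : ℕ) : ZMod (D + 1)) := by
    push_cast
    rw [ZMod.natCast_zmod_val]
    ring
  rcases Nat.lt_or_ge (i - a).val D with h | h
  · left
    refine ⟨h, ?_⟩
    rw [hi, ZMod.val_natCast_of_lt (by omega)]
  · right
    have h' : (i - a).val = D := by omega
    refine ⟨h', ?_⟩
    rw [hi, h', ZMod.natCast_self, ZMod.val_zero]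

lemma exit_iff {a i : ZMod (D + 1)} {l : ℕ} (h1 : 1 ≤ l) (hl : l ≤ D) :
    (i ∈ arc D a l ∧ i + 1 ∉ arc D a l) ↔ i = a + ((l - 1 : ℕ) : ZMod (D + 1)) := by
  rw [mem_arc (by omega), mem_arc (by omega), ← val_sub_eq (by omega)]
  have := val_succ_sub (a := a) (i := i)
  omega

lemma entry_iff {a i : ZMod (D + 1)} {l : ℕ} (h1 : 1 ≤ l) (hl : l ≤ D) :
    (i ∉ arc D a l ∧ i + 1 ∈ arc D a l) ↔ i + 1 = a := by
  have : i + 1 = a ↔ (i + 1 - a).val = 0 := by rw [ZMod.val_eq_zero, sub_eq_zero]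
  rw [mem_arc (by omega), mem_arc (by omega), this]
  have := val_succ_sub (a := a) (i := i)
  omega

lemma exit_unique {I : Finset (ZMod (D + 1))} (hI : IsInterval D I) {i j : ZMod (D + 1)}
    (hi : i ∈ I) (hi' : i + 1 ∉ I) (hj : j ∈ I) (hj' : j + 1 ∉ I) : i = j := by
  obtain ⟨a, l, h1, hl, rfl⟩ := isInterval_iff.1 hI
  rw [(exit_iff h1 hl).1 ⟨hi, hi'⟩, (exit_iff h1 hl).1 ⟨hj, hj'⟩]

lemma card_boundary {I : Finset (ZMod (D + 1))} (hI : IsInterval D I) :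
    (Finset.univ.filter fun i => ¬ (i ∈ I ↔ i + 1 ∈ I)).card = 2 := by
  obtain ⟨a, l, h1, hl, rfl⟩ := isInterval_iff.1 hI
  rw [Finset.card_eq_two]
  refine ⟨a + ((l - 1 : ℕ) : ZMod (D + 1)), a - 1, ?_, ?_⟩
  · intro h
    have hx := (exit_iff (a := a) h1 hl).2 rfl
    rw [h, sub_add_cancel] at hx
    exact hx.2 ((mem_arc (by omega)).2 (by rw [sub_self, ZMod.val_zero]; omega))
  · ext i
    have hx := exit_iff (a := a) (i := i) h1 hl
    have hn := entry_iff (a := a) (i := i) h1 hl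
    rw [← eq_sub_iff_add_eq] at hn
    simp only [Finset.mem_filter, Finset.mem_univ, true_and, Finset.mem_insert,
      Finset.mem_singleton, ← hx, ← hn]
    tauto

lemma mem_evSet_arc {a c : ZMod (D + 1)} {l : ℕ} (ho : Odd l) (hl : l ≤ D)
    (hc : c ∈ arc D a l) (ht : Odd (c - a).val) : c ∈ evSet D (arc D a l) := by
  classical
  have hlt := (mem_arc (by omega)).1 hc
  obtain ⟨t, hteq⟩ : ∃ t, t = (c - a).val := ⟨_, rfl⟩
  rw [← hteq] at ht hlt
  have hce : c = a + (t : ZMod (D + 1)) := (val_sub_eq (by omega)).1 hteq.symm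
  have hlt' : Odd (l - 1 - t) := by
    obtain ⟨p, rfl⟩ := ho
    obtain ⟨q, rfl⟩ := ht
    exact ⟨p - q - 1, by omega⟩
  have hpos := hlt'.pos
  have hshift : ∀ i : ZMod (D + 1), i ∈ arc D (a + ((t + 1 : ℕ) : ZMod (D + 1))) (l - 1 - t) ↔
      t < (i - a).val ∧ (i - a).val < l := by
    intro i
    simp only [arc, Finset.mem_image, Finset.mem_range]
    constructor
    · rintro ⟨s, hs, rfl⟩
      have : a + ((t + 1 : ℕ) : ZMod (D + 1)) + (s : ZMod (D + 1)) =
        a + ((t + 1 + s : ℕ) : ZMod (D + 1)) := by push_cast; ring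
      rw [this, (val_sub_eq (t := t + 1 + s) (by omega)).2 rfl]
      omega
    · rintro ⟨h1, h2⟩
      refine ⟨(i - a).val - (t + 1), by omega, ?_⟩
      rw [add_assoc, ← Nat.cast_add]
      exact ((val_sub_eq (by omega)).1 (by omega)).symm
  have hne : ∀ i : ZMod (D + 1), i ≠ c ↔ (i - a).val ≠ t := by
    intro i
    rw [hce, Ne, ← val_sub_eq (by omega)]
  have hunion : (arc D a l).erase c =
      arc D a t ∪ arc D (a + ((t + 1 : ℕ) : ZMod (D + 1))) (l - 1 - t) := by
    ext i
    rw [Finset.mem_erase, Finset.mem_union, hshift, mem_arc (by omega), mem_arc (by omega), hne]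
    omega
  simp only [evSet, Finset.mem_filter]
  refine ⟨hc, _, _, oddInterval_arc ht (by omega), oddInterval_arc hlt' (by omega), ⟨?_, ?_⟩,
    hunion⟩
  · ext i
    rw [Finset.mem_inter, hshift, mem_arc (by omega)]
    simp only [Finset.notMem_empty, iff_false]
    omega
  · rw [← hunion]
    intro hint
    have htp := ht.pos
    have h1 : (c - 1 - a).val = t - 1 := by
      rw [val_sub_eq (by omega), hce, Nat.cast_sub (by omega)]
      push_cast
      ring
    obtain ⟨hx, hx'⟩ := (exit_iff (a := a) ho.pos hl).2 rfl
    have h2 := (val_sub_eq (a := a) (t := l - 1) (by omega)).2 rfl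
    have heq := exit_unique hint (i := c - 1) (j := a + ((l - 1 : ℕ) : ZMod (D + 1)))
      (by rw [Finset.mem_erase, hne, mem_arc (by omega)]; omega) (by simp)
      (by rw [Finset.mem_erase, hne, mem_arc (by omega)]; omega)
      (fun h => hx' (Finset.mem_of_mem_erase h))
    rw [← heq] at h2
    omega

lemma mem_evSet_or_succ_mem_evSet {I : Finset (ZMod (D + 1))} (hI : OddInterval D I)
    {i : ZMod (D + 1)} (hi : i ∈ I) (hi' : i + 1 ∈ I) : i ∈ evSet D I ∨ i + 1 ∈ evSet D I := by
  obtain ⟨a, l, ho, hl, rfl⟩ := OddInterval.exists_arc hI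
  have h1 := (mem_arc (by omega)).1 hi
  rcases val_succ_sub (a := a) (i := i) with ⟨_, h⟩ | ⟨h, _⟩
  · rcases Nat.even_or_odd (i - a).val with he | hod
    · exact Or.inr (mem_evSet_arc ho hl hi' (h ▸ he.add_one))
    · exact Or.inl (mem_evSet_arc ho hl hi hod)
  · omega

lemma isInterval_union (hDev : Even D) {I I' : Finset (ZMod (D + 1))}
    (hI : OddInterval D I) (hI' : OddInterval D I') (hd : I ∩ I' = ∅) {i : ZMod (D + 1)}
    (hi : i ∈ I) (hi' : i + 1 ∈ I') : IsInterval D (I ∪ I') := by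
  have hcard := Finset.card_union_of_disjoint (Finset.disjoint_iff_inter_eq_empty.2 hd)
  have hle := Finset.card_le_univ (I ∪ I')
  rw [ZMod.card] at hle
  obtain ⟨a, l, ho, hl, rfl⟩ := OddInterval.exists_arc hI
  obtain ⟨b, l', ho', hl', rfl⟩ := OddInterval.exists_arc hI'
  rw [card_arc (by omega), card_arc (by omega)] at hcard
  have hsum : l + l' ≤ D := by
    obtain ⟨p, rfl⟩ := ho
    obtain ⟨q, rfl⟩ := ho'
    obtain ⟨r, rfl⟩ := hDev
    omega
  have hdis : ∀ x, x ∈ arc D a l → x ∈ arc D b l' → False := fun x hx hx' => by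
    have := Finset.mem_inter.2 ⟨hx, hx'⟩
    rw [hd] at this
    simp at this
  have h1 := (exit_iff ho.pos hl).1 ⟨hi, fun h => hdis _ h hi'⟩
  have h2 := (entry_iff ho'.pos hl').1 ⟨fun h => hdis _ hi h, hi'⟩
  have hb : b = a + (l : ZMod (D + 1)) := by
    rw [← h2, h1, Nat.cast_sub ho.pos]
    push_cast
    ring
  refine isInterval_iff.2 ⟨a, l + l', Nat.le_add_right_of_le ho.pos, hsum, ?_⟩
  apply Finset.eq_of_subset_of_card_le
  · intro x hx
    rcases Finset.mem_union.1 hx with hx | hx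
    · rw [mem_arc (by omega)] at hx ⊢
      omega
    · simp only [arc, Finset.mem_image, Finset.mem_range] at hx ⊢
      obtain ⟨t, ht, rfl⟩ := hx
      exact ⟨l + t, by omega, by rw [hb]; push_cast; ring⟩
  · rw [hcard, card_arc (by omega)]

lemma exists_evSet_of_ssubset_of_exit {K K' : Finset (ZMod (D + 1))} (hK : OddInterval D K)
    (hK' : OddInterval D K') (hs : K ⊂ K') {i : ZMod (D + 1)} (hi : i ∈ K) (hi' : i + 1 ∉ K') :
    ∃ c, c ∈ evSet D K' ∧ c ∉ K ∧ c + 1 ∈ K := by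
  have hcard := Finset.card_lt_card hs
  have hsub := hs.1
  obtain ⟨b, l, ho, hl, rfl⟩ := OddInterval.exists_arc hK
  obtain ⟨a, l', ho', hl', rfl⟩ := OddInterval.exists_arc hK'
  rw [card_arc (by omega), card_arc (by omega)] at hcard
  have h1 := (exit_iff ho.pos hl).1 ⟨hi, fun h => hi' (hsub h)⟩
  have h2 := (exit_iff ho'.pos hl').1 ⟨hsub hi, hi'⟩
  have hp := ho.pos
  obtain ⟨hn, hn'⟩ := (entry_iff (a := b) (i := b - 1) ho.pos hl).2 (by ring)
  have hc : (b - 1 - a).val = l' - l - 1 := by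
    rw [val_sub_eq (by omega), Nat.cast_sub (by omega), Nat.cast_sub (by omega)]
    rw [h1, Nat.cast_sub (by omega), Nat.cast_sub (by omega)] at h2
    push_cast at h2 ⊢
    linear_combination h2
  refine ⟨b - 1, mem_evSet_arc ho' hl' ?_ ?_, hn, hn'⟩
  · rw [mem_arc (by omega)]
    omega
  · rw [hc]
    obtain ⟨p, rfl⟩ := ho
    obtain ⟨q, rfl⟩ := ho'
    exact ⟨q - p - 1, by omega⟩

lemma exists_evSet_of_ssubset_of_entry {K K' : Finset (ZMod (D + 1))} (hK : OddInterval D K)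
    (hK' : OddInterval D K') (hs : K ⊂ K') {i : ZMod (D + 1)} (hi : i ∉ K') (hi' : i + 1 ∈ K) :
    ∃ c, c ∈ K ∧ c + 1 ∉ K ∧ c + 1 ∈ evSet D K' := by
  have hcard := Finset.card_lt_card hs
  have hsub := hs.1
  obtain ⟨b, l, ho, hl, rfl⟩ := OddInterval.exists_arc hK
  obtain ⟨a, l', ho', hl', rfl⟩ := OddInterval.exists_arc hK'
  rw [card_arc (by omega), card_arc (by omega)] at hcard
  have h1 := (entry_iff ho.pos hl).1 ⟨fun h => hi (hsub h), hi'⟩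
  have h2 := (entry_iff ho'.pos hl').1 ⟨hi, hsub hi'⟩
  obtain rfl : b = a := h1.symm.trans h2
  obtain ⟨hx, hx'⟩ := (exit_iff (a := b) ho.pos hl).2 rfl
  have hc : (b + ((l - 1 : ℕ) : ZMod (D + 1)) + 1 - b).val = l := by
    rw [val_sub_eq (by omega), Nat.cast_sub ho.pos]
    push_cast
    ring
  refine ⟨_, hx, hx', mem_evSet_arc ho' hl' ?_ ?_⟩
  · rw [mem_arc (by omega)]
    omega
  · rwa [hc]

lemma exists_cover {B : Finset (Finset (ZMod (D + 1)))} (hB : phi D B)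
    {I : Finset (ZMod (D + 1))} (hI : I ∈ B) {c : ZMod (D + 1)} (hc : c ∈ evSet D I) :
    ∃ J ∈ B, J ⊂ I ∧ c ∈ J := by
  obtain ⟨𝒥, hsub, hprec, -, hcov⟩ := hB.2.2 I hI
  obtain ⟨J, hJ, hcJ⟩ := Finset.mem_biUnion.1 (hcov hc)
  exact ⟨J, hsub hJ, (hprec J hJ).1, hcJ⟩

lemma ssubset_of_mem_of_mem {B : Finset (Finset (ZMod (D + 1)))} (hB : phi D B)
    {I J : Finset (ZMod (D + 1))} (hI : I ∈ B) (hJ : J ∈ B) {i : ZMod (D + 1)}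
    (hiI : i ∈ I) (hiJ : i ∈ J) : I = J ∨ I ⊂ J ∨ J ⊂ I := by
  rcases hB.2.1 I hI J hJ with h | h | h | h
  · exact Or.inl h
  · have := Finset.mem_inter.2 ⟨hiI, hiJ⟩
    rw [h.1] at this
    simp at this
  · exact Or.inr (Or.inl h.1)
  · exact Or.inr (Or.inr h.1)

/-- Two members of `B` on either side of an edge of the cycle are nested. -/
lemma ssubset_of_mem_of_succ_mem (hDev : Even D) {B : Finset (Finset (ZMod (D + 1)))}
    (hB : phi D B) {I J : Finset (ZMod (D + 1))} (hI : I ∈ B) (hJ : J ∈ B)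
    {i : ZMod (D + 1)} (hiI : i ∈ I) (hiJ : i + 1 ∈ J) : I = J ∨ I ⊂ J ∨ J ⊂ I := by
  rcases hB.2.1 I hI J hJ with h | h | h | h
  · exact Or.inl h
  · exact absurd (isInterval_union hDev (hB.1 I hI) (hB.1 J hJ) h.1 hiI hiJ) h.2
  · exact Or.inr (Or.inl h.1)
  · exact Or.inr (Or.inr h.1)

lemma not_ssubset_of_exit (hDev : Even D) {B : Finset (Finset (ZMod (D + 1)))} (hB : phi D B)
    {K K' : Finset (ZMod (D + 1))} (hK : K ∈ B) (hK' : K' ∈ B)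
    {i : ZMod (D + 1)} (hi : i ∈ K) (hi' : i + 1 ∉ K') : ¬ K ⊂ K' := by
  intro hs
  obtain ⟨M, hM, hmax⟩ := Finset.exists_max_image (B.filter fun J => i ∈ J ∧ J ⊂ K')
    Finset.card ⟨K, by simp [hK, hi, hs]⟩
  simp only [Finset.mem_filter] at hM hmax
  obtain ⟨hMB, hiM, hMK⟩ := hM
  obtain ⟨c, hc, hcM, hcM'⟩ :=
    exists_evSet_of_ssubset_of_exit (hB.1 M hMB) (hB.1 K' hK') hMK hiM hi'
  obtain ⟨J, hJ, hJK, hcJ⟩ := exists_cover hB hK' hc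
  rcases ssubset_of_mem_of_succ_mem hDev hB hJ hMB hcJ hcM' with rfl | h | h
  · exact hcM hcJ
  · exact hcM (h.1 hcJ)
  · exact absurd (hmax J ⟨hJ, h.1 hiM, hJK⟩) (not_le.2 (Finset.card_lt_card h))

lemma not_ssubset_of_entry (hDev : Even D) {B : Finset (Finset (ZMod (D + 1)))} (hB : phi D B)
    {K K' : Finset (ZMod (D + 1))} (hK : K ∈ B) (hK' : K' ∈ B)
    {i : ZMod (D + 1)} (hi : i ∉ K') (hi' : i + 1 ∈ K) : ¬ K ⊂ K' := by
  intro hs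
  obtain ⟨M, hM, hmax⟩ := Finset.exists_max_image (B.filter fun J => i + 1 ∈ J ∧ J ⊂ K')
    Finset.card ⟨K, by simp [hK, hi', hs]⟩
  simp only [Finset.mem_filter] at hM hmax
  obtain ⟨hMB, hiM, hMK⟩ := hM
  obtain ⟨c, hcM, hcM', hc⟩ :=
    exists_evSet_of_ssubset_of_entry (hB.1 M hMB) (hB.1 K' hK') hMK hi hiM
  obtain ⟨J, hJ, hJK, hcJ⟩ := exists_cover hB hK' hc
  rcases ssubset_of_mem_of_succ_mem hDev hB hMB hJ hcM hcJ with rfl | h | h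
  · exact hcM' hcJ
  · exact absurd (hmax J ⟨hJ, h.1 hiM, hJK⟩) (not_le.2 (Finset.card_lt_card h))
  · exact hcM' (h.1 hcJ)

/-- At most one member of `B` has a boundary at a given edge of the cycle. -/
lemma boundary_unique (hDev : Even D) {B : Finset (Finset (ZMod (D + 1)))} (hB : phi D B)
    {K K' : Finset (ZMod (D + 1))} (hK : K ∈ B) (hK' : K' ∈ B) {i : ZMod (D + 1)}
    (hi : ¬ (i ∈ K ↔ i + 1 ∈ K)) (hi' : ¬ (i ∈ K' ↔ i + 1 ∈ K')) : K = K' := by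
  by_cases h1 : i ∈ K <;> by_cases h2 : i ∈ K' <;> simp only [h1, h2, true_iff, false_iff,
    not_not] at hi hi'
  · rcases ssubset_of_mem_of_mem hB hK hK' h1 h2 with h | h | h
    · exact h
    · exact absurd h (not_ssubset_of_exit hDev hB hK hK' h1 hi')
    · exact absurd h (not_ssubset_of_exit hDev hB hK' hK h2 hi)
  · rcases ssubset_of_mem_of_succ_mem hDev hB hK hK' h1 hi' with h | h | h
    · exact h
    · exact absurd (h.1 h1) h2
    · exact absurd (h.1 hi') hi
  · rcases ssubset_of_mem_of_succ_mem hDev hB hK' hK h2 hi with h | h | h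
    · exact h.symm
    · exact absurd (h.1 h2) h1
    · exact absurd (h.1 hi) hi'
  · rcases ssubset_of_mem_of_mem hB hK hK' hi hi' with h | h | h
    · exact h
    · exact absurd h (not_ssubset_of_entry hDev hB hK hK' h2 hi)
    · exact absurd h (not_ssubset_of_entry hDev hB hK' hK h1 hi')

/-- An edge of the cycle touching a member of `B` is on the boundary of a member of `B`. -/
lemma exists_boundary {B : Finset (Finset (ZMod (D + 1)))} (hB : phi D B) {i : ZMod (D + 1)}
    (h : ∃ I ∈ B, i ∈ I ∨ i + 1 ∈ I) : ∃ K ∈ B, ¬ (i ∈ K ↔ i + 1 ∈ K) := by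
  by_contra! hno
  obtain ⟨I, hI, hiI⟩ := h
  have hiff := hno I hI
  obtain ⟨M, hM, hmin⟩ := Finset.exists_min_image (B.filter fun J => i ∈ J)
    Finset.card ⟨I, by simp only [Finset.mem_filter]; tauto⟩
  simp only [Finset.mem_filter] at hM hmin
  obtain ⟨hMB, hiM⟩ := hM
  rcases mem_evSet_or_succ_mem_evSet (hB.1 M hMB) hiM ((hno M hMB).1 hiM) with hc | hc
  · obtain ⟨J, hJ, hJM, hcJ⟩ := exists_cover hB hMB hc
    exact absurd (hmin J ⟨hJ, hcJ⟩) (not_le.2 (Finset.card_lt_card hJM))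
  · obtain ⟨J, hJ, hJM, hcJ⟩ := exists_cover hB hMB hc
    exact absurd (hmin J ⟨hJ, (hno J hJ).2 hcJ⟩) (not_le.2 (Finset.card_lt_card hJM))

/-- The edges `(i, i+1)` of the cycle touching a member of `B`. -/
def touched (B : Finset (Finset (ZMod (D + 1)))) : Finset (ZMod (D + 1)) :=
  Finset.univ.filter fun i => ∃ I ∈ B, i ∈ I ∨ i + 1 ∈ I

lemma card_touched (hDev : Even D) {B : Finset (Finset (ZMod (D + 1)))} (hB : phi D B) :
    (touched B).card = 2 * B.card := by
  have h := Finset.sum_card_bipartiteAbove_eq_sum_card_bipartiteBelow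
    (s := touched B) (t := B) (fun i K => ¬ (i ∈ K ↔ i + 1 ∈ K))
  rw [Finset.sum_congr rfl (g := fun _ => 1), Finset.sum_congr rfl (s₁ := B) (g := fun _ => 2)] at h
  · simpa [mul_comm] using h
  · intro K hK
    rw [← card_boundary (hB.1 K hK).1]
    congr 1
    ext i
    simp only [Finset.bipartiteBelow, touched, Finset.mem_filter, Finset.mem_univ, true_and,
      and_iff_right_iff_imp]
    intro hi
    exact ⟨K, hK, by tauto⟩
  · intro i hi
    simp only [touched, Finset.mem_filter, Finset.mem_univ, true_and] at hi
    obtain ⟨K, hK, hiK⟩ := exists_boundary hB hi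
    rw [Finset.card_eq_one]
    refine ⟨K, ?_⟩
    ext K'
    simp only [Finset.bipartiteAbove, Finset.mem_filter, Finset.mem_singleton]
    constructor
    · rintro ⟨h1, h2⟩
      exact boundary_unique hDev hB h1 hK h2 hiK
    · rintro rfl
      exact ⟨hK, hiK⟩

/-- The members of `B` containing `i`. -/
def through (B : Finset (Finset (ZMod (D + 1)))) (i : ZMod (D + 1)) :
    Finset (Finset (ZMod (D + 1))) := B.filter fun I => i ∈ I

/-- `j` lies one level deeper than `i` in the nested family `B`. -/
def Deeper (B : Finset (Finset (ZMod (D + 1)))) (i j : ZMod (D + 1)) : Prop :=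
  ∃ K ∈ B, K ∉ through B i ∧ through B j = insert K (through B i) ∧ ∀ I ∈ through B i, K ⊂ I

lemma edge_cases (hDev : Even D) {B : Finset (Finset (ZMod (D + 1)))} (hB : phi D B)
    (i : ZMod (D + 1)) :
    (through B i = ∅ ∧ through B (i + 1) = ∅) ∨ Deeper B i (i + 1) ∨ Deeper B (i + 1) i := by
  by_cases h : ∃ I ∈ B, i ∈ I ∨ i + 1 ∈ I
  · right
    obtain ⟨K, hK, hiK⟩ := exists_boundary hB h
    have hrest : ∀ I ∈ B, I ≠ K → (i ∈ I ↔ i + 1 ∈ I) := by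
      intro I hI hne
      by_contra hi
      exact hne (boundary_unique hDev hB hI hK hi hiK)
    by_cases hi : i ∈ K
    · have hi' : i + 1 ∉ K := by tauto
      refine Or.inr ⟨K, hK, by simp [through, hi'], ?_, ?_⟩
      · ext I
        simp only [through, Finset.mem_filter, Finset.mem_insert]
        by_cases hIK : I = K
        · simp [hIK, hK, hi]
        · simp only [hIK, false_or, and_congr_right_iff]
          exact fun hI => hrest I hI hIK
      · intro I hI
        simp only [through, Finset.mem_filter] at hI
        rcases ssubset_of_mem_of_succ_mem hDev hB hK hI.1 hi hI.2 with rfl | h | h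
        · exact absurd hI.2 hi'
        · exact h
        · exact absurd (h.1 hI.2) hi'
    · have hi' : i + 1 ∈ K := by tauto
      refine Or.inl ⟨K, hK, by simp [through, hi], ?_, ?_⟩
      · ext I
        simp only [through, Finset.mem_filter, Finset.mem_insert]
        by_cases hIK : I = K
        · simp [hIK, hK, hi']
        · simp only [hIK, false_or, and_congr_right_iff]
          exact fun hI => (hrest I hI hIK).symm
      · intro I hI
        simp only [through, Finset.mem_filter] at hI
        rcases ssubset_of_mem_of_succ_mem hDev hB hI.1 hK hI.2 hi' with rfl | h | h
        · exact absurd hI.2 hi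
        · exact absurd (h.1 hI.2) hi
        · exact h
  · left
    push Not at h
    simp only [through, Finset.filter_eq_empty_iff]
    exact ⟨fun I hI => (h I hI).1, fun I hI => (h I hI).2⟩

/-- The alternating sum of the coefficients `c` along the members of `B` containing `i`,
starting from the innermost one. -/
def altSum (B : Finset (Finset (ZMod (D + 1)))) (c : Finset (ZMod (D + 1)) → ZMod 2)
    (i : ZMod (D + 1)) : ℤ :=
  ∑ I ∈ through B i, ((c I).val : ℤ) * (-1) ^ ((through B i).filter (· ⊂ I)).card

lemma altSum_add_of_deeper {B : Finset (Finset (ZMod (D + 1)))}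
    (c : Finset (ZMod (D + 1)) → ZMod 2) {i j : ZMod (D + 1)} (h : Deeper B i j) :
    altSum B c i + altSum B c j = 0 ∨ altSum B c i + altSum B c j = 1 := by
  obtain ⟨K, -, hKi, hj, hmin⟩ := h
  have key : altSum B c i + altSum B c j = ((c K).val : ℤ) := by
    have hK : ((insert K (through B i)).filter (· ⊂ K)) = ∅ := by
      rw [Finset.filter_eq_empty_iff]
      intro I hI
      rcases Finset.mem_insert.1 hI with rfl | hI
      · exact fun h => h.ne rfl
      · exact fun h => (h.trans (hmin I hI)).ne rfl
    have hI : ∀ I ∈ through B i, ((insert K (through B i)).filter (· ⊂ I)).card =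
        ((through B i).filter (· ⊂ I)).card + 1 := by
      intro I hI
      rw [Finset.filter_insert, if_pos (hmin I hI), Finset.card_insert_of_notMem]
      simp [hKi]
    unfold altSum
    rw [hj, Finset.sum_insert hKi, hK, add_left_comm, ← Finset.sum_add_distrib,
      Finset.sum_eq_zero fun I h => by rw [hI I h]; ring]
    simp
  rw [key]
  have := ZMod.val_lt (c K)
  omega

lemma altSum_add_succ (hDev : Even D) {B : Finset (Finset (ZMod (D + 1)))} (hB : phi D B)
    (c : Finset (ZMod (D + 1)) → ZMod 2) (i : ZMod (D + 1)) :
    altSum B c i + altSum B c (i + 1) = 0 ∨ altSum B c i + altSum B c (i + 1) = 1 := by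
  rcases edge_cases hDev hB i with ⟨h, h'⟩ | h | h
  · simp [altSum, h, h']
  · exact altSum_add_of_deeper c h
  · rw [add_comm]
    exact altSum_add_of_deeper c h

lemma altSum_cast (B : Finset (Finset (ZMod (D + 1)))) (c : Finset (ZMod (D + 1)) → ZMod 2)
    (i : ZMod (D + 1)) : ((altSum B c i : ℤ) : ZMod 2) = ∑ I ∈ through B i, c I := by
  rw [altSum, Int.cast_sum]
  refine Finset.sum_congr rfl fun I _ => ?_
  rw [show ((((c I).val : ℤ) * (-1) ^ ((through B i).filter (· ⊂ I)).card : ℤ) : ZMod 2) =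
    (((c I).val : ℕ) : ZMod 2) * (-1) ^ ((through B i).filter (· ⊂ I)).card by push_cast; rfl,
    ZMod.natCast_zmod_val, ZMod.neg_eq_self_mod_two, one_pow, mul_one]

/-- The sequence `0, 1, -1, 2, -2, …`. -/
def zigzag (g : ℕ) : ℤ := if Even g then -((g / 2 : ℕ) : ℤ) else ((g + 1) / 2 : ℕ)

lemma zigzag_eq_zero {g : ℕ} : zigzag g = 0 ↔ g = 0 := by
  unfold zigzag
  split_ifs with h
  · obtain ⟨k, rfl⟩ := h
    omega
  · omega

lemma zigzag_add_succ (g : ℕ) : zigzag g + zigzag (g + 1) = 0 ∨ zigzag g + zigzag (g + 1) = 1 := by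
  unfold zigzag
  rcases Nat.even_or_odd g with h | h
  · rw [if_pos h, if_neg (by simpa [Nat.even_add_one] using h)]
    obtain ⟨k, rfl⟩ := h
    omega
  · have h' := Nat.not_even_iff_odd.2 h
    rw [if_neg h', if_pos (by simpa [Nat.even_add_one] using h')]
    omega

lemma zigzag_cast (g : ℕ) : ((zigzag g : ℤ) : ZMod 2) = ((g * (g + 1) / 2 : ℕ) : ZMod 2) := by
  unfold zigzag
  have h2 : (2 : ZMod 2) = 0 := rfl
  rcases Nat.even_or_odd' g with ⟨k, rfl | rfl⟩
  · rw [if_pos (even_two_mul k), show 2 * k * (2 * k + 1) / 2 = k * (2 * k + 1) by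
      rw [mul_assoc]; exact Nat.mul_div_cancel_left _ two_pos,
      show 2 * k / 2 = k by omega]
    push_cast
    rw [ZMod.neg_eq_self_mod_two, h2]
    ring
  · rw [if_neg (by simp), show (2 * k + 1) * (2 * k + 1 + 1) / 2 = (2 * k + 1) * (k + 1) by
      rw [show (2 * k + 1) * (2 * k + 1 + 1) = 2 * ((2 * k + 1) * (k + 1)) by ring]
      exact Nat.mul_div_cancel_left _ two_pos,
      show (2 * k + 1 + 1) / 2 = k + 1 by omega]
    push_cast
    rw [h2]
    ring

lemma gB_eq_card_through (B : Finset (Finset (ZMod (D + 1)))) (i : ZMod (D + 1)) :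
    gB D B i = (through B i).card := by
  unfold gB through
  congr

lemma zigzag_gB_add_of_deeper {B : Finset (Finset (ZMod (D + 1)))} {i j : ZMod (D + 1)}
    (h : Deeper B i j) : zigzag (gB D B i) + zigzag (gB D B j) = 0 ∨
      zigzag (gB D B i) + zigzag (gB D B j) = 1 := by
  obtain ⟨K, -, hKi, hj, -⟩ := h
  rw [gB_eq_card_through B j, hj, Finset.card_insert_of_notMem hKi, ← gB_eq_card_through]
  exact zigzag_add_succ _

lemma zigzag_gB_add_succ (hDev : Even D) {B : Finset (Finset (ZMod (D + 1)))} (hB : phi D B)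
    (i : ZMod (D + 1)) : zigzag (gB D B i) + zigzag (gB D B (i + 1)) = 0 ∨
      zigzag (gB D B i) + zigzag (gB D B (i + 1)) = 1 := by
  rcases edge_cases hDev hB i with ⟨h, h'⟩ | h | h
  · simp [gB_eq_card_through, h, h', zigzag]
  · exact zigzag_gB_add_of_deeper h
  · rw [add_comm]
    exact zigzag_gB_add_of_deeper h

lemma sum_smul_eV (w : Wsp D) :
    ∑ i, w i • eV D i = (Submodule.Quotient.mk w : Vsp D) := by
  conv_rhs => rw [← Finset.univ_sum_single w]
  rw [← Submodule.mkQ_apply, map_sum]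
  refine Finset.sum_congr rfl fun i _ => ?_
  rw [eV, Submodule.mkQ_apply, ← Submodule.Quotient.mk_smul, ← Pi.single_smul, smul_eq_mul, mul_one]

lemma sum_smul_eSet (B : Finset (Finset (ZMod (D + 1))))
    (c : Finset (ZMod (D + 1)) → ZMod 2) :
    ∑ I ∈ B, c I • eSet D I =
      (Submodule.Quotient.mk (fun i => ∑ I ∈ through B i, c I) : Vsp D) := by
  rw [← sum_smul_eV]
  simp only [eSet, Finset.smul_sum, Finset.sum_smul, through, Finset.sum_filter]
  rw [Finset.sum_comm]
  refine Finset.sum_congr rfl fun I _ => ?_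
  simp

/-- An integral lift with consecutive sums in `{0, 1}` is determined by its class in `V_D`. -/
lemma lift_unique (hDev : Even D) {m m' : ZMod (D + 1) → ℤ}
    (hm : ∀ i, m i + m (i + 1) = 0 ∨ m i + m (i + 1) = 1)
    (hm' : ∀ i, m' i + m' (i + 1) = 0 ∨ m' i + m' (i + 1) = 1)
    (h : (Submodule.Quotient.mk (fun i => (m i : ZMod 2)) : Vsp D) =
      Submodule.Quotient.mk (fun i => (m' i : ZMod 2))) : m = m' := by
  obtain ⟨a, ha⟩ := Submodule.mem_span_singleton.1 ((Submodule.Quotient.eq _).1 h)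
  have hconst : ∀ i, (m i : ZMod 2) - m' i = a := fun i => by
    simpa [allOnes] using (congrFun ha i).symm
  have hstep : ∀ i, m (i + 1) - m' (i + 1) = -(m i - m' i) := by
    intro i
    have hc : ((m i + m (i + 1) : ℤ) : ZMod 2) = ((m' i + m' (i + 1) : ℤ) : ZMod 2) := by
      have h1 := hconst i
      have h2 := hconst (i + 1)
      have h3 := CharTwo.add_self_eq_zero a
      push_cast
      linear_combination h1 + h2 + h3
    rw [ZMod.intCast_eq_intCast_iff_dvd_sub] at hc
    have := hm i
    have := hm' i
    push_cast at hc
    omega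
  have hiter : ∀ (n : ℕ) (i : ZMod (D + 1)),
      m (i + n) - m' (i + n) = (-1) ^ n * (m i - m' i) := by
    intro n i
    induction n with
    | zero => simp
    | succ n ih =>
      rw [Nat.cast_succ, ← add_assoc, hstep, ih, pow_succ]
      ring
  ext i
  have := hiter (D + 1) i
  rw [ZMod.natCast_self, add_zero, hDev.add_one.neg_one_pow] at this
  omega

lemma card_le_of_epsB_mem (hDev : Even D) {A' A : Finset (Finset (ZMod (D + 1)))}
    (hA' : phi D A') (hA : phi D A) (h : epsB D A' ∈ spanB D A) : A'.card ≤ A.card := by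
  obtain ⟨c, hc⟩ := (Submodule.mem_span_image_finset_iff_exists_fun' (ZMod 2)).1 h
  have heq : (fun i => zigzag (gB D A' i)) = altSum A c := by
    apply lift_unique hDev (zigzag_gB_add_succ hDev hA') (altSum_add_succ hDev hA c)
    simp only [zigzag_cast, altSum_cast]
    rw [← sum_smul_eSet, hc, ← sum_smul_eV]
    rfl
  have hvan : ∀ i, (∃ I ∈ A', i ∈ I) → ∃ I ∈ A, i ∈ I := by
    rintro i ⟨I, hI, hiI⟩
    by_contra! hno
    have h0 : through A i = ∅ := by
      rw [through, Finset.filter_eq_empty_iff]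
      exact fun J hJ => hno J hJ
    have h1 := congrFun heq i
    rw [altSum, h0, Finset.sum_empty, zigzag_eq_zero, gB_eq_card_through, Finset.card_eq_zero,
      through, Finset.filter_eq_empty_iff] at h1
    exact h1 hI hiI
  have hsub : touched A' ⊆ touched A := by
    intro i
    simp only [touched, Finset.mem_filter, Finset.mem_univ, true_and]
    rintro ⟨I, hI, hi | hi⟩
    · obtain ⟨J, hJ, hJi⟩ := hvan i ⟨I, hI, hi⟩
      exact ⟨J, hJ, Or.inl hJi⟩
    · obtain ⟨J, hJ, hJi⟩ := hvan (i + 1) ⟨I, hI, hi⟩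
      exact ⟨J, hJ, Or.inr hJi⟩
  have := Finset.card_le_card hsub
  rw [card_touched hDev hA', card_touched hDev hA] at this
  omega

end CyclicArc

/-- Corollary 2.5: if `A' ≤ A` in `φ(V_D)` then `|A'| ≤ |A|`. -/
theorem corollary_2_5 (D : ℕ) (hD : 2 ≤ D) (hDev : Even D)
    (A' A : Finset (Finset (ZMod (D + 1))))
    (hA' : phi D A') (hA : phi D A) (h : leφ D A' A) :
    A'.card ≤ A.card := by
  obtain ⟨k, c, rfl, rfl, hphi, hstep⟩ := h
  have hmono : ∀ n ≤ k, (c 0).card ≤ (c n).card := by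
    intro n hn
    induction n with
    | zero => exact le_rfl
    | succ n ih =>
      exact (ih (by omega)).trans (CyclicArc.card_le_of_epsB_mem hDev (hphi n (by omega))
        (hphi (n + 1) hn) (hstep n (by omega)))
  exact hmono k le_rfl
end

section
/- Theorem 2.4: Let C ∈ φ(V_D) and let r : φ(V_D) → ℤ satisfy δ_{ε(C)} = Σ_{B ∈ φ(V_D)} r(B) · 1_{⟨B⟩} in ℂ[V_D]. Then every B ∈ φ(V_D) with r(B) ≠ 0 satisfies |B| ≤ |C|. -/
open scoped BigOperators

/-- The arc `{s, s + σ, …, s + (l - 1) σ}`, used for `σ = 1` and `σ = -1`. -/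
def arc (D : ℕ) (s σ : ZMod (D + 1)) (l : ℕ) : Finset (ZMod (D + 1)) :=
  (Finset.range l).image (fun t : ℕ => s + σ * (t : ZMod (D + 1)))

section Arcs

variable {D : ℕ} {s σ p x : ZMod (D + 1)} {l : ℕ} {I J : Finset (ZMod (D + 1))}

lemma mem_arc : x ∈ arc D s σ l ↔ ∃ t < l, s + σ * (t : ZMod (D + 1)) = x := by
  simp [arc]

lemma natCast_self_eq_neg_one : (D : ZMod (D + 1)) = -1 := by
  have h : ((D + 1 : ℕ) : ZMod (D + 1)) = 0 := ZMod.natCast_self _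
  push_cast at h
  exact eq_neg_of_add_eq_zero_left h

lemma add_mul_natCast_injective (hσ : σ = 1 ∨ σ = -1) {a b : ℕ} (ha : a ≤ D) (hb : b ≤ D)
    (h : s + σ * (a : ZMod (D + 1)) = s + σ * (b : ZMod (D + 1))) : a = b := by
  have h' : (a : ZMod (D + 1)) = b := by
    rcases hσ with rfl | rfl <;> simpa using h
  rw [ZMod.natCast_eq_natCast_iff', Nat.mod_eq_of_lt (by omega), Nat.mod_eq_of_lt (by omega)] at h'
  exact h'

lemma add_mul_natCast_mem_arc (hσ : σ = 1 ∨ σ = -1) (hl : l ≤ D) {t : ℕ} (ht : t ≤ D) :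
    s + σ * (t : ZMod (D + 1)) ∈ arc D s σ l ↔ t < l := by
  rw [mem_arc]
  refine ⟨?_, fun h => ⟨t, h, rfl⟩⟩
  rintro ⟨t', ht', h⟩
  have := add_mul_natCast_injective hσ (by omega) ht h
  omega

lemma sub_notMem_arc (hσ : σ = 1 ∨ σ = -1) (hl : l ≤ D) : s - σ ∉ arc D s σ l := by
  have h : s - σ = s + σ * (D : ZMod (D + 1)) := by rw [natCast_self_eq_neg_one]; ring
  rw [h, add_mul_natCast_mem_arc hσ hl le_rfl]
  omega

lemma eq_start_of_mem_arc (hp : p ∈ arc D s σ l) (hp' : p - σ ∉ arc D s σ l) : p = s := by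
  obtain ⟨t, ht, rfl⟩ := mem_arc.1 hp
  rcases t with _ | t
  · simp
  · refine absurd (mem_arc.2 ⟨t, by omega, ?_⟩) hp'
    push_cast
    ring

lemma arc_reverse (hl : 1 ≤ l) :
    arc D s σ l = arc D (s + σ * ((l - 1 : ℕ) : ZMod (D + 1))) (-σ) l := by
  ext x
  simp only [mem_arc]
  constructor
  · rintro ⟨t, ht, rfl⟩
    refine ⟨l - 1 - t, by omega, ?_⟩
    rw [Nat.cast_sub (by omega : t ≤ l - 1)]
    ring
  · rintro ⟨t, ht, rfl⟩
    refine ⟨l - 1 - t, by omega, ?_⟩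
    rw [Nat.cast_sub (by omega : t ≤ l - 1)]
    ring

lemma isInterval_iff_arc (hσ : σ = 1 ∨ σ = -1) :
    IsInterval D I ↔ ∃ s l, 1 ≤ l ∧ l ≤ D ∧ I = arc D s σ l := by
  have h1 : IsInterval D I ↔ ∃ s l, 1 ≤ l ∧ l ≤ D ∧ I = arc D s 1 l := by
    simp [IsInterval, arc]
  rw [h1]
  rcases hσ with rfl | rfl
  · rfl
  · constructor
    · rintro ⟨s, l, h, h', rfl⟩
      exact ⟨_, l, h, h', arc_reverse h⟩
    · rintro ⟨s, l, h, h', rfl⟩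
      have hrev := arc_reverse (s := s) (σ := -1) h
      rw [neg_neg] at hrev
      exact ⟨_, l, h, h', hrev⟩

lemma card_arc (hσ : σ = 1 ∨ σ = -1) (hl : l ≤ D) : (arc D s σ l).card = l := by
  rw [arc, Finset.card_image_of_injOn, Finset.card_range]
  intro a ha b hb h
  simp only [Finset.coe_range, Set.mem_Iio] at ha hb
  exact add_mul_natCast_injective hσ (by omega) (by omega) h

lemma oddInterval_arc (hσ : σ = 1 ∨ σ = -1) (hl : l ≤ D) (hl' : Odd l) :
    OddInterval D (arc D s σ l) :=
  ⟨(isInterval_iff_arc hσ).2 ⟨s, l, hl'.pos, hl, rfl⟩, by rwa [card_arc hσ hl]⟩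

lemma OddInterval.exists_eq_arc (hI : OddInterval D I) (hσ : σ = 1 ∨ σ = -1) :
    ∃ s m, 2 * m + 1 ≤ D ∧ I = arc D s σ (2 * m + 1) := by
  obtain ⟨⟨s, l, -, hl, rfl⟩, hodd⟩ := hI.imp_left (isInterval_iff_arc hσ).1
  rw [card_arc hσ hl] at hodd
  obtain ⟨m, rfl⟩ := hodd
  exact ⟨s, m, hl, rfl⟩

lemma OddInterval.eq_arc (hI : OddInterval D I) (hσ : σ = 1 ∨ σ = -1) (hp : p ∈ I)
    (hp' : p - σ ∉ I) : ∃ m, 2 * m + 1 ≤ D ∧ I = arc D p σ (2 * m + 1) := by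
  obtain ⟨s, m, hm, rfl⟩ := hI.exists_eq_arc hσ
  obtain rfl := eq_start_of_mem_arc hp hp'
  exact ⟨m, hm, rfl⟩

lemma OddInterval.existsUnique_start (hI : OddInterval D I) (hσ : σ = 1 ∨ σ = -1) :
    ∃! p, p ∈ I ∧ p - σ ∉ I := by
  obtain ⟨s, m, hm, rfl⟩ := hI.exists_eq_arc hσ
  exact ⟨s, ⟨mem_arc.2 ⟨0, by omega, by simp⟩, sub_notMem_arc hσ hm⟩,
    fun p hp => eq_start_of_mem_arc hp.1 hp.2⟩

lemma mem_evSet_arc (hσ : σ = 1 ∨ σ = -1) {m j : ℕ} (hm : 2 * m + 1 ≤ D) (hj : j < m) :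
    s + σ * ((2 * j + 1 : ℕ) : ZMod (D + 1)) ∈ evSet D (arc D s σ (2 * m + 1)) := by
  have herase : (arc D s σ (2 * m + 1)).erase (s + σ * ((2 * j + 1 : ℕ) : ZMod (D + 1))) =
      arc D s σ (2 * j + 1) ∪
        arc D (s + σ * ((2 * j + 2 : ℕ) : ZMod (D + 1))) σ (2 * (m - j - 1) + 1) := by
    ext x
    simp only [Finset.mem_erase, Finset.mem_union, mem_arc]
    constructor
    · rintro ⟨hne, t, ht, rfl⟩
      rcases lt_trichotomy t (2 * j + 1) with h | h | h
      · exact Or.inl ⟨t, h, rfl⟩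
      · exact absurd (by rw [h]) hne
      · refine Or.inr ⟨t - (2 * j + 2), by omega, ?_⟩
        rw [Nat.cast_sub (by omega : 2 * j + 2 ≤ t)]
        ring
    · rintro (⟨t, ht, rfl⟩ | ⟨t, ht, rfl⟩)
      · refine ⟨fun h => ?_, t, by omega, rfl⟩
        have := add_mul_natCast_injective hσ (by omega) (by omega) h
        omega
      · have h2 : s + σ * ((2 * j + 2 : ℕ) : ZMod (D + 1)) + σ * (t : ZMod (D + 1)) =
            s + σ * ((2 * j + 2 + t : ℕ) : ZMod (D + 1)) := by push_cast; ring
        rw [h2]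
        refine ⟨fun h => ?_, 2 * j + 2 + t, by omega, rfl⟩
        have := add_mul_natCast_injective hσ (by omega) (by omega) h
        omega
  refine (@Finset.mem_filter _ _ (Classical.decPred _) _ _).2 ⟨(add_mul_natCast_mem_arc hσ hm (by omega)).2 (by omega), _, _,
    oddInterval_arc hσ (by omega) ⟨j, rfl⟩, oddInterval_arc hσ (by omega) ⟨m - j - 1, rfl⟩,
    ⟨?_, ?_⟩, herase⟩
  · ext x
    simp only [Finset.mem_inter, mem_arc, Finset.notMem_empty, iff_false]
    rintro ⟨⟨t, ht, rfl⟩, t', ht', h⟩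
    have h2 : s + σ * ((2 * j + 2 + t' : ℕ) : ZMod (D + 1)) = s + σ * (t : ZMod (D + 1)) := by
      rw [← h]; push_cast; ring
    have := add_mul_natCast_injective hσ (by omega) (by omega) h2
    omega
  · rw [← herase]
    intro hK
    obtain ⟨k, l, -, hl, hKeq⟩ := (isInterval_iff_arc hσ).1 hK
    have h0 : s = k := by
      refine eq_start_of_mem_arc (l := l) (σ := σ) ?_ ?_
      · rw [← hKeq, herase]
        exact Finset.mem_union_left _ (mem_arc.2 ⟨0, by omega, by simp⟩)
      · rw [← hKeq]
        exact fun h => sub_notMem_arc hσ hm (Finset.mem_of_mem_erase h)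
    have h1 : s + σ * ((2 * j + 2 : ℕ) : ZMod (D + 1)) = k := by
      refine eq_start_of_mem_arc (l := l) (σ := σ) ?_ ?_
      · rw [← hKeq, herase]
        exact Finset.mem_union_right _ (mem_arc.2 ⟨0, by omega, by simp⟩)
      · rw [← hKeq]
        have h2 : s + σ * ((2 * j + 2 : ℕ) : ZMod (D + 1)) - σ =
            s + σ * ((2 * j + 1 : ℕ) : ZMod (D + 1)) := by push_cast; ring
        rw [h2]
        exact Finset.notMem_erase _ _
    have h3 : s + σ * ((2 * j + 2 : ℕ) : ZMod (D + 1)) = s + σ * ((0 : ℕ) : ZMod (D + 1)) := by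
      rw [h1, ← h0]; simp
    have := add_mul_natCast_injective hσ (by omega) (by omega) h3
    omega

lemma isInterval_union_of_adjacent_aux (hD : Even D) (hI : OddInterval D I)
    (hJ : OddInterval D J) (hdisj : I ∩ J = ∅) (hp : p ∈ I) (hp' : p - 1 ∈ J) :
    IsInterval D (I ∪ J) := by
  have hd : Disjoint I J := Finset.disjoint_iff_inter_eq_empty.2 hdisj
  obtain ⟨m, hm, rfl⟩ := hI.eq_arc (Or.inl rfl) hp (Finset.disjoint_right.1 hd hp')
  obtain ⟨n, hn, rfl⟩ := hJ.eq_arc (σ := -1) (Or.inr rfl) hp'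
    (by simpa using Finset.disjoint_left.1 hd hp)
  have hcard := Finset.card_le_univ (arc D p 1 (2 * m + 1) ∪ arc D (p - 1) (-1) (2 * n + 1))
  rw [Finset.card_union_of_disjoint hd, card_arc (Or.inl rfl) hm, card_arc (Or.inr rfl) hn,
    ZMod.card] at hcard
  obtain ⟨d, rfl⟩ := hD
  refine (isInterval_iff_arc (Or.inl rfl)).2
    ⟨p - ((2 * n + 1 : ℕ) : ZMod _), 2 * n + 1 + (2 * m + 1), by omega, by omega, ?_⟩
  ext x
  simp only [Finset.mem_union, mem_arc]
  constructor
  · rintro (⟨t, ht, rfl⟩ | ⟨t, ht, rfl⟩)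
    · exact ⟨2 * n + 1 + t, by omega, by push_cast; ring⟩
    · refine ⟨2 * n - t, by omega, ?_⟩
      rw [Nat.cast_sub (by omega : t ≤ 2 * n)]
      push_cast
      ring
  · rintro ⟨t, ht, rfl⟩
    rcases lt_or_ge t (2 * n + 1) with h | h
    · refine Or.inr ⟨2 * n - t, by omega, ?_⟩
      rw [Nat.cast_sub (by omega : t ≤ 2 * n)]
      push_cast
      ring
    · refine Or.inl ⟨t - (2 * n + 1), by omega, ?_⟩
      rw [Nat.cast_sub h]
      ring

lemma isInterval_union_of_adjacent (hD : Even D) (hI : OddInterval D I) (hJ : OddInterval D J)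
    (hσ : σ = 1 ∨ σ = -1) (hdisj : I ∩ J = ∅) (hp : p ∈ I) (hp' : p - σ ∈ J) :
    IsInterval D (I ∪ J) := by
  rcases hσ with rfl | rfl
  · exact isInterval_union_of_adjacent_aux hD hI hJ hdisj hp hp'
  · rw [Finset.union_comm]
    refine isInterval_union_of_adjacent_aux hD hJ hI (by rwa [Finset.inter_comm]) hp' ?_
    simpa using hp

end Arcs

section Laminar

variable {D : ℕ} {B : Finset (Finset (ZMod (D + 1)))} {I J : Finset (ZMod (D + 1))}
  {σ p i : ZMod (D + 1)}

lemma phi.exists_prec_of_mem_evSet (hB : phi D B) (hI : I ∈ B) (hi : i ∈ evSet D I) :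
    ∃ K ∈ B, K ⊂ I ∧ i ∈ K := by
  obtain ⟨𝒥, h𝒥, hprec, -, hcov⟩ := hB.2.2 I hI
  obtain ⟨K, hK, hiK⟩ := Finset.mem_biUnion.1 (hcov hi)
  exact ⟨K, h𝒥 hK, (hprec K hK).1, hiK⟩

lemma phi.ssubset_or_ssubset (hB : phi D B) (hI : I ∈ B) (hJ : J ∈ B) (hne : I ≠ J)
    (hpI : p ∈ I) (hpJ : p ∈ J) : I ⊂ J ∨ J ⊂ I := by
  rcases hB.2.1 I hI J hJ with h | h | h | h
  · exact absurd h hne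
  · have : p ∈ I ∩ J := Finset.mem_inter.2 ⟨hpI, hpJ⟩
    rw [h.1] at this
    exact absurd this (Finset.notMem_empty _)
  · exact Or.inl h.1
  · exact Or.inr h.1

lemma phi.inter_nonempty_of_adjacent (hD : Even D) (hB : phi D B) (hσ : σ = 1 ∨ σ = -1)
    (hI : I ∈ B) (hJ : J ∈ B) (hpI : p ∈ I) (hpJ : p - σ ∈ J) : (I ∩ J).Nonempty := by
  rcases hB.2.1 I hI J hJ with rfl | h | h | h
  · exact ⟨p, by simpa using hpI⟩
  · exact absurd (isInterval_union_of_adjacent hD (hB.1 I hI) (hB.1 J hJ) hσ h.1 hpI hpJ) h.2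
  · exact ⟨p, Finset.mem_inter.2 ⟨hpI, h.1.1 hpI⟩⟩
  · exact ⟨p - σ, Finset.mem_inter.2 ⟨h.1.1 hpJ, hpJ⟩⟩

lemma phi.not_ssubset_of_start (hD : Even D) (hB : phi D B) (hσ : σ = 1 ∨ σ = -1)
    (hI : I ∈ B) (hJ : J ∈ B) (hp' : p - σ ∉ I) (hpJ : p ∈ J) : ¬ J ⊂ I := by
  intro hJI
  obtain ⟨K, hK, hmax⟩ := Finset.exists_max_image (B.filter fun K => K ⊂ I ∧ p ∈ K) Finset.card
    ⟨J, Finset.mem_filter.2 ⟨hJ, hJI, hpJ⟩⟩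
  obtain ⟨hKB, hKI, hpK⟩ := Finset.mem_filter.1 hK
  obtain ⟨m, hm, hIeq⟩ := (hB.1 I hI).eq_arc hσ (hKI.1 hpK) hp'
  obtain ⟨n, hn, hKeq⟩ := (hB.1 K hKB).eq_arc hσ hpK (fun h => hp' (hKI.1 h))
  have hcard := Finset.card_lt_card hKI
  rw [hIeq, hKeq, card_arc hσ hm, card_arc hσ hn] at hcard
  have hev := mem_evSet_arc (s := p) hσ hm (by omega : n < m)
  rw [← hIeq] at hev
  set q := p + σ * ((2 * n + 1 : ℕ) : ZMod (D + 1)) with hq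
  obtain ⟨L, hLB, hLI, hqL⟩ := hB.exists_prec_of_mem_evSet hI hev
  have hqK : q ∉ K := by
    rw [hKeq, hq, add_mul_natCast_mem_arc hσ hn (by omega)]
    omega
  have hqK' : q - σ ∈ K := by
    rw [hKeq, mem_arc]
    exact ⟨2 * n, by omega, by rw [hq]; push_cast; ring⟩
  obtain ⟨z, hz⟩ := hB.inter_nonempty_of_adjacent hD hσ hLB hKB hqL hqK'
  rw [Finset.mem_inter] at hz
  rcases hB.ssubset_or_ssubset hLB hKB (fun h => hqK (h ▸ hqL)) hz.1 hz.2 with h | h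
  · exact hqK (h.1 hqL)
  · exact (Finset.card_lt_card h).not_ge
      (hmax L (Finset.mem_filter.2 ⟨hLB, hLI, h.1 hpK⟩))

/-- An interval of `B` through the first point `p` of `I ∈ B` contains `I`, and strictly more than
`I` on the near side of `p`, unless it is `I`. -/
lemma phi.ssubset_of_mem_start (hD : Even D) (hB : phi D B) (hσ : σ = 1 ∨ σ = -1)
    (hI : I ∈ B) (hJ : J ∈ B) (hp : p ∈ I) (hp' : p - σ ∉ I) (hpJ : p ∈ J) (hne : J ≠ I) :
    I ⊂ J ∧ p - σ ∈ J := by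
  rcases hB.ssubset_or_ssubset hJ hI hne hpJ hp with h | h
  · exact absurd h (hB.not_ssubset_of_start hD hσ hI hJ hp' hpJ)
  · refine ⟨h, ?_⟩
    by_contra hJ'
    exact hB.not_ssubset_of_start hD hσ hJ hI hJ' hp h

lemma phi.mem_iff_of_start (hD : Even D) (hB : phi D B) (hσ : σ = 1 ∨ σ = -1)
    (hI : I ∈ B) (hJ : J ∈ B) (hp : p ∈ I) (hp' : p - σ ∉ I) (hne : J ≠ I) :
    p ∈ J ↔ p - σ ∈ J := by
  refine ⟨fun h => (hB.ssubset_of_mem_start hD hσ hI hJ hp hp' h hne).2, fun h => ?_⟩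
  obtain ⟨z, hz⟩ := hB.inter_nonempty_of_adjacent hD hσ hI hJ hp h
  rw [Finset.mem_inter] at hz
  rcases hB.ssubset_or_ssubset hI hJ hne.symm hz.1 hz.2 with h' | h'
  · exact h'.1 hp
  · exact absurd (h'.1 h) hp'

/-- The members of `B` through `p`. -/
def through (D : ℕ) (B : Finset (Finset (ZMod (D + 1)))) (p : ZMod (D + 1)) :
    Finset (Finset (ZMod (D + 1))) :=
  B.filter fun I => p ∈ I

/-- The number of members of `B` that contain `I`. -/
def depth (D : ℕ) (B : Finset (Finset (ZMod (D + 1)))) (I : Finset (ZMod (D + 1))) : ℕ :=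
  (B.filter fun J => I ⊆ J).card

lemma mem_through : I ∈ through D B p ↔ I ∈ B ∧ p ∈ I := by
  simp [through]

lemma card_through : (through D B p).card = gB D B p := rfl

lemma phi.depth_eq_of_start (hD : Even D) (hB : phi D B) (hσ : σ = 1 ∨ σ = -1)
    (hI : I ∈ B) (hp : p ∈ I) (hp' : p - σ ∉ I) : depth D B I = gB D B p := by
  rw [depth, gB]
  congr 1
  refine Finset.filter_congr fun J hJ => ⟨fun h => h hp, fun h => ?_⟩
  by_cases hne : J = I
  · exact hne ▸ subset_rfl
  · exact (hB.ssubset_of_mem_start hD hσ hI hJ hp hp' h hne).1.1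

lemma phi.through_eq_of_start (hD : Even D) (hB : phi D B) (hσ : σ = 1 ∨ σ = -1)
    (hI : I ∈ B) (hp : p ∈ I) (hp' : p - σ ∉ I) :
    I ∉ through D B (p - σ) ∧ through D B p = insert I (through D B (p - σ)) := by
  refine ⟨fun h => hp' (mem_through.1 h).2, ?_⟩
  ext J
  rw [Finset.mem_insert, mem_through, mem_through]
  by_cases hne : J = I
  · simp [hne, hI, hp]
  · simp only [hne, false_or]
    exact and_congr_right fun hJ => hB.mem_iff_of_start hD hσ hI hJ hp hp' hne

lemma phi.gB_eq_of_start (hD : Even D) (hB : phi D B) (hσ : σ = 1 ∨ σ = -1)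
    (hI : I ∈ B) (hp : p ∈ I) (hp' : p - σ ∉ I) : gB D B p = gB D B (p - σ) + 1 := by
  obtain ⟨h1, h2⟩ := hB.through_eq_of_start hD hσ hI hp hp'
  rw [← card_through, h2, Finset.card_insert_of_notMem h1, card_through]

lemma phi.through_eq_empty (hB : phi D B)
    (h : ∀ I ∈ B, (p ∈ I ↔ p - 1 ∈ I)) : through D B p = ∅ := by
  by_contra hne
  obtain ⟨I, hI, hmin⟩ := Finset.exists_min_image _ Finset.card (Finset.nonempty_iff_ne_empty.2 hne)
  obtain ⟨hIB, hpI⟩ := mem_through.1 hI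
  have hpI' := (h I hIB).1 hpI
  obtain ⟨s, m, hm, hIeq⟩ := (hB.1 I hIB).exists_eq_arc (σ := 1) (Or.inl rfl)
  have hev : p ∈ evSet D I ∨ p - 1 ∈ evSet D I := by
    rw [hIeq] at hpI hpI' ⊢
    obtain ⟨t, ht, rfl⟩ := mem_arc.1 hpI
    rcases Nat.even_or_odd' t with ⟨j, rfl | rfl⟩
    · right
      rcases j with _ | j
      · refine absurd hpI' ?_
        simpa using sub_notMem_arc (s := s) (Or.inl rfl) hm
      · convert mem_evSet_arc (s := s) (Or.inl rfl) hm (by omega : j < m) using 1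
        push_cast
        ring
    · exact Or.inl (mem_evSet_arc (Or.inl rfl) hm (by omega))
  have key : ∃ K ∈ B, K ⊂ I ∧ p ∈ K := by
    rcases hev with hev | hev
    · exact hB.exists_prec_of_mem_evSet hIB hev
    · obtain ⟨K, hK, hKI, hpK⟩ := hB.exists_prec_of_mem_evSet hIB hev
      exact ⟨K, hK, hKI, (h K hK).2 hpK⟩
  obtain ⟨K, hK, hKI, hpK⟩ := key
  exact (Finset.card_lt_card hKI).not_ge (hmin K (mem_through.2 ⟨hK, hpK⟩))

/-- At each point exactly one interval of `B` starts, or exactly one has just ended, or no interval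
of `B` is near. -/
lemma phi.trichotomy (hD : Even D) (hB : phi D B) (p : ZMod (D + 1)) :
    (∃ I ∈ B, I ∉ through D B (p - 1) ∧ through D B p = insert I (through D B (p - 1)) ∧
      depth D B I = gB D B p) ∨
    (∃ I ∈ B, I ∉ through D B p ∧ through D B (p - 1) = insert I (through D B p) ∧
      depth D B I = gB D B (p - 1)) ∨
    (through D B p = ∅ ∧ through D B (p - 1) = ∅) := by
  by_cases h : ∀ I ∈ B, (p ∈ I ↔ p - 1 ∈ I)
  · right; right
    have h0 := hB.through_eq_empty h
    refine ⟨h0, ?_⟩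
    rw [← h0]
    exact Finset.filter_congr fun I hI => (h I hI).symm
  · push Not at h
    obtain ⟨I, hI, ⟨hp, hp'⟩ | ⟨hp, hp'⟩⟩ := h
    · have := hB.through_eq_of_start hD (Or.inl rfl) hI hp hp'
      exact Or.inl ⟨I, hI, this.1, this.2, hB.depth_eq_of_start hD (Or.inl rfl) hI hp hp'⟩
    · have hp2 : p - 1 - -1 ∉ I := by simpa using hp
      have := hB.through_eq_of_start hD (Or.inr rfl) hI hp' hp2
      rw [sub_neg_eq_add, sub_add_cancel] at this
      exact Or.inr (Or.inl ⟨I, hI, this.1, this.2,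
        hB.depth_eq_of_start hD (Or.inr rfl) hI hp' hp2⟩)

/-- The numerical shadow of `phi.trichotomy`. -/
lemma phi.gB_trichotomy (hD : Even D) (hB : phi D B) (p : ZMod (D + 1)) :
    gB D B p = gB D B (p - 1) + 1 ∨ gB D B (p - 1) = gB D B p + 1 ∨
      (gB D B p = 0 ∧ gB D B (p - 1) = 0) := by
  simp only [← card_through]
  rcases hB.trichotomy hD p with ⟨I, -, h, h', -⟩ | ⟨I, -, h, h', -⟩ | ⟨h, h'⟩
  · left; rw [h', Finset.card_insert_of_notMem h]
  · right; left; rw [h', Finset.card_insert_of_notMem h]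
  · right; right; simp [h, h']

end Laminar

section Profile

variable {D : ℕ} {B C : Finset (Finset (ZMod (D + 1)))} {I J : Finset (ZMod (D + 1))}
  {σ p i : ZMod (D + 1)}

lemma gB_le_of_start (hD : Even D) (hB : phi D B) (hσ : σ = 1 ∨ σ = -1)
    (hI : I ∈ B) (hp : p ∈ I) (hp' : p - σ ∉ I) (hi : i ∈ I) : gB D B p ≤ gB D B i := by
  rw [← hB.depth_eq_of_start hD hσ hI hp hp', depth, gB]
  exact Finset.card_le_card (Finset.monotone_filter_right _ fun J _ hJ => hJ hi)

lemma length_le_of_gB_eq (hD : Even D) (hB : phi D B) (hC : phi D C) (h : gB D B = gB D C)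
    {m n : ℕ} (hm : 2 * m + 1 ≤ D) (hn : 2 * n + 1 ≤ D)
    (hI : arc D p 1 (2 * m + 1) ∈ B) (hJ : arc D p 1 (2 * n + 1) ∈ C) : n ≤ m := by
  have h1 : (1 : ZMod (D + 1)) = 1 ∨ (1 : ZMod (D + 1)) = -1 := Or.inl rfl
  by_contra hlt
  set q := p + 1 * ((2 * m + 1 : ℕ) : ZMod (D + 1)) with hq
  have hpI : p ∈ arc D p 1 (2 * m + 1) := mem_arc.2 ⟨0, by omega, by simp⟩
  have hpJ : p ∈ arc D p 1 (2 * n + 1) := mem_arc.2 ⟨0, by omega, by simp⟩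
  have hqI : q - 1 - -1 ∉ arc D p 1 (2 * m + 1) := by
    rw [sub_neg_eq_add, sub_add_cancel, hq, add_mul_natCast_mem_arc h1 hm hm]
    omega
  have hqI' : q - 1 ∈ arc D p 1 (2 * m + 1) :=
    mem_arc.2 ⟨2 * m, by omega, by rw [hq]; push_cast; ring⟩
  have hqJ : q ∈ arc D p 1 (2 * n + 1) := mem_arc.2 ⟨2 * m + 1, by omega, hq.symm⟩
  have e1 := hB.gB_eq_of_start hD (Or.inr rfl) hI hqI' hqI
  rw [← hB.depth_eq_of_start hD (Or.inr rfl) hI hqI' hqI,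
    hB.depth_eq_of_start hD h1 hI hpI (sub_notMem_arc h1 hm), sub_neg_eq_add, sub_add_cancel] at e1
  have e2 := gB_le_of_start hD hC h1 hJ hpJ (sub_notMem_arc h1 hn) hqJ
  rw [← h] at e2
  omega

lemma subset_of_gB_eq (hD : Even D) (hB : phi D B) (hC : phi D C) (h : gB D B = gB D C) :
    B ⊆ C := by
  intro I hI
  have h1 : (1 : ZMod (D + 1)) = 1 ∨ (1 : ZMod (D + 1)) = -1 := Or.inl rfl
  obtain ⟨p, ⟨hp, hp'⟩, -⟩ := (hB.1 I hI).existsUnique_start h1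
  have hg := hB.gB_eq_of_start hD h1 hI hp hp'
  rw [h] at hg
  obtain ⟨J, hJ, hpJ, hpJ'⟩ : ∃ J ∈ C, p ∈ J ∧ p - 1 ∉ J := by
    by_contra! hno
    have : through D C p ⊆ through D C (p - 1) := fun J hJ =>
      mem_through.2 ⟨(mem_through.1 hJ).1, hno J (mem_through.1 hJ).1 (mem_through.1 hJ).2⟩
    have := Finset.card_le_card this
    rw [card_through, card_through] at this
    omega
  obtain ⟨m, hm, rfl⟩ := (hB.1 I hI).eq_arc h1 hp hp'
  obtain ⟨n, hn, rfl⟩ := (hC.1 J hJ).eq_arc h1 hpJ hpJ'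
  have e1 := length_le_of_gB_eq hD hB hC h hm hn hI hJ
  have e2 := length_le_of_gB_eq hD hC hB h.symm hn hm hJ hI
  obtain rfl := le_antisymm e1 e2
  exact hJ

lemma eq_of_gB_eq (hD : Even D) (hB : phi D B) (hC : phi D C) (h : gB D B = gB D C) : B = C :=
  (subset_of_gB_eq hD hB hC h).antisymm (subset_of_gB_eq hD hC hB h.symm)

lemma phi.card_eq_sum_starts (hB : phi D B) (hσ : σ = 1 ∨ σ = -1) :
    B.card = ∑ p, (B.filter fun I => p ∈ I ∧ p - σ ∉ I).card := by
  have := Finset.sum_card_bipartiteAbove_eq_sum_card_bipartiteBelow (s := B)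
    (t := (Finset.univ : Finset (ZMod (D + 1)))) (fun I p => p ∈ I ∧ p - σ ∉ I)
  simp only [Finset.bipartiteAbove, Finset.bipartiteBelow] at this
  rw [← this, Finset.card_eq_sum_ones]
  refine Finset.sum_congr rfl fun I hI => ?_
  obtain ⟨p, hp, huniq⟩ := (hB.1 I hI).existsUnique_start hσ
  rw [eq_comm, Finset.card_eq_one]
  refine ⟨p, ?_⟩
  ext q
  simp only [Finset.mem_filter, Finset.mem_univ, true_and, Finset.mem_singleton]
  exact ⟨huniq q, fun h => h ▸ hp⟩

lemma filter_mem_and_notMem : (B.filter fun I => p ∈ I ∧ i ∉ I) = through D B p \ through D B i := by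
  ext I
  simp only [Finset.mem_filter, Finset.mem_sdiff, mem_through]
  tauto

lemma phi.two_mul_card (hD : Even D) (hB : phi D B) :
    2 * B.card =
      (Finset.univ.filter fun p => ¬ (gB D B p = 0 ∧ gB D B (p - 1) = 0)).card := by
  have h1 := hB.card_eq_sum_starts (σ := 1) (Or.inl rfl)
  have h2 := hB.card_eq_sum_starts (σ := -1) (Or.inr rfl)
  rw [← Equiv.sum_comp (Equiv.subRight (1 : ZMod (D + 1)))] at h2
  rw [two_mul]
  nth_rewrite 1 [h1]
  rw [h2, ← Finset.sum_add_distrib, Finset.card_filter]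
  refine Finset.sum_congr rfl fun p _ => ?_
  simp only [Equiv.subRight_apply, sub_neg_eq_add, sub_add_cancel, filter_mem_and_notMem]
  rcases hB.trichotomy hD p with ⟨I, -, h, h', -⟩ | ⟨I, -, h, h', -⟩ | ⟨h, h'⟩
  · have hne : gB D B p ≠ 0 := by simp [← card_through, h']
    rw [if_pos (fun hz => hne hz.1), h', Finset.insert_sdiff_of_notMem _ h]
    simp
  · have hne : gB D B (p - 1) ≠ 0 := by simp [← card_through, h']
    rw [if_pos (fun hz => hne hz.2), h', Finset.insert_sdiff_of_notMem _ h]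
    simp
  · simp [← card_through, h, h']

lemma card_le_of_gB_le (hD : Even D) (hB : phi D B) (hC : phi D C) (h : gB D B ≤ gB D C) :
    B.card ≤ C.card := by
  have hle := Finset.card_le_card (Finset.monotone_filter_right
    (Finset.univ : Finset (ZMod (D + 1)))
    (p := fun p => ¬ (gB D B p = 0 ∧ gB D B (p - 1) = 0))
    (q := fun p => ¬ (gB D C p = 0 ∧ gB D C (p - 1) = 0))
    fun p _ hp hp' => hp ⟨Nat.le_zero.1 ((h p).trans hp'.1.le),
      Nat.le_zero.1 ((h (p - 1)).trans hp'.2.le)⟩)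
  rw [← hB.two_mul_card hD, ← hC.two_mul_card hD] at hle
  omega

end Profile

section Signs

variable {D : ℕ} {B C : Finset (Finset (ZMod (D + 1)))}

lemma eq_of_add_shift_eq (hD : Even D) {R R' : ZMod (D + 1) → ℤ}
    (h : ∀ p, R p + R (p - 1) = R' p + R' (p - 1)) : R = R' := by
  have key : ∀ (t : ℕ) (p : ZMod (D + 1)),
      R (p - t) - R' (p - t) = (-1) ^ t * (R p - R' p) := by
    intro t
    induction t with
    | zero => simp
    | succ t ih =>
      intro p
      have h1 := h (p - t)
      have h2 := ih p
      rw [pow_succ]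
      push_cast
      rw [← sub_sub]
      linarith
  funext p
  have := key (D + 1) p
  rw [ZMod.natCast_self, sub_zero, hD.add_one.neg_one_pow] at this
  linarith

/-- The nontrivial character of `ZMod 2`. -/
def signChar (z : ZMod 2) : ℤ := (-1) ^ z.val

lemma signChar_add (a b : ZMod 2) : signChar (a + b) = signChar a * signChar b := by
  revert a b; decide

lemma signChar_natCast (n : ℕ) : signChar (n : ZMod 2) = (-1) ^ n := by
  induction n with
  | zero => rfl
  | succ n ih =>
    rw [Nat.cast_succ, signChar_add, ih, pow_succ]
    rfl

lemma abs_signChar (a : ZMod 2) : |signChar a| = 1 := by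
  revert a; decide

/-- The parity of the triangular number `n (n + 1) / 2`. -/
def triParity (n : ℕ) : ZMod 2 := ((n * (n + 1) / 2 : ℕ) : ZMod 2)

lemma triParity_succ (n : ℕ) : triParity (n + 1) = triParity n + ((n + 1 : ℕ) : ZMod 2) := by
  have h : (n + 1) * (n + 1 + 1) / 2 = n * (n + 1) / 2 + (n + 1) := by
    rw [← Nat.add_mul_div_right _ _ (by norm_num : 0 < 2)]
    congr 1
    ring
  rw [triParity, triParity, h, Nat.cast_add]

lemma signChar_triParity_succ_add (n : ℕ) :
    2 * signChar (triParity (n + 1) + triParity n) =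
      (-1) ^ (n + 1) * (1 + 2 * ((n + 1 : ℕ) : ℤ)) + (-1) ^ n * (1 + 2 * (n : ℤ)) := by
  have h : triParity (n + 1) + triParity n = ((n + 1 : ℕ) : ZMod 2) := by
    rw [triParity_succ, add_right_comm, CharTwo.add_self_eq_zero, zero_add]
  rw [h, signChar_natCast]
  push_cast
  ring

lemma phi.signChar_triParity_gB (hD : Even D) (hC : phi D C) (p : ZMod (D + 1)) :
    (-1) ^ gB D C p * (1 + 2 * (gB D C p : ℤ)) +
      (-1) ^ gB D C (p - 1) * (1 + 2 * (gB D C (p - 1) : ℤ)) =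
    2 * signChar (triParity (gB D C p) + triParity (gB D C (p - 1))) := by
  rcases hC.gB_trichotomy hD p with h | h | ⟨h, h'⟩
  · rw [h, signChar_triParity_succ_add]
  · rw [h, add_comm (triParity _), signChar_triParity_succ_add, add_comm]
  · rw [h, h']
    rfl

/-- The signed count of the members of `B` through `i`, weighted by depth and by `c`. -/
def signedCount (D : ℕ) (B : Finset (Finset (ZMod (D + 1))))
    (c : Finset (ZMod (D + 1)) → ZMod 2) (i : ZMod (D + 1)) : ℤ :=
  ∑ I ∈ through D B i, (-1) ^ depth D B I * signChar (c I)

lemma abs_signedCount_le (c : Finset (ZMod (D + 1)) → ZMod 2) (i : ZMod (D + 1)) :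
    |signedCount D B c i| ≤ gB D B i := by
  refine (Finset.abs_sum_le_sum_abs _ _).trans ?_
  simp [abs_mul, abs_signChar, card_through]

lemma signChar_sum_step {F G : Finset (Finset (ZMod (D + 1)))} {I : Finset (ZMod (D + 1))}
    (hI : I ∉ G) (hF : F = insert I G) (c : Finset (ZMod (D + 1)) → ZMod 2)
    (w : Finset (ZMod (D + 1)) → ℤ) (hw : w I = (-1) ^ F.card * signChar (c I)) :
    (-1) ^ F.card * (1 + 2 * ∑ J ∈ F, w J) + (-1) ^ G.card * (1 + 2 * ∑ J ∈ G, w J) =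
      2 * signChar (∑ J ∈ F, c J + ∑ J ∈ G, c J) := by
  have hc : ∑ J ∈ F, c J + ∑ J ∈ G, c J = c I := by
    rw [hF, Finset.sum_insert hI, add_assoc, CharTwo.add_self_eq_zero, add_zero]
  have hcard : F.card = G.card + 1 := by rw [hF, Finset.card_insert_of_notMem hI]
  have hs : ((-1 : ℤ) ^ G.card) * (-1) ^ G.card = 1 := by
    rw [← mul_pow]; simp
  rw [hc]
  nth_rewrite 2 [hF]
  rw [Finset.sum_insert hI, hw, hcard, pow_succ]
  linear_combination (2 * signChar (c I)) * hs

lemma phi.signChar_signedCount (hD : Even D) (hB : phi D B)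
    (c : Finset (ZMod (D + 1)) → ZMod 2) (p : ZMod (D + 1)) :
    (-1) ^ gB D B p * (1 + 2 * signedCount D B c p) +
      (-1) ^ gB D B (p - 1) * (1 + 2 * signedCount D B c (p - 1)) =
    2 * signChar (∑ I ∈ through D B p, c I + ∑ I ∈ through D B (p - 1), c I) := by
  simp only [signedCount, ← card_through]
  rcases hB.trichotomy hD p with ⟨I, -, h, h', hd⟩ | ⟨I, -, h, h', hd⟩ | ⟨h, h'⟩
  · exact signChar_sum_step h h' c _ (by rw [hd, card_through])
  · rw [add_comm, add_comm (∑ I ∈ through D B p, c I)]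
    exact signChar_sum_step h h' c _ (by rw [hd, card_through])
  · simp [h, h', signChar]

end Signs

section Span

variable {D : ℕ} {B C : Finset (Finset (ZMod (D + 1)))}

lemma sum_smul_eV (x : Wsp D) : ∑ i, x i • eV D i = Submodule.Quotient.mk x := by
  have h : x = ∑ i, x i • (Pi.single i 1 : Wsp D) := by
    simp [Pi.single_apply, funext_iff]
  conv_rhs => rw [h]
  simp only [eV, ← Submodule.mkQ_apply, map_sum, map_smul]

lemma eSet_eq_mk (I : Finset (ZMod (D + 1))) :
    eSet D I = Submodule.Quotient.mk (fun i => if i ∈ I then 1 else 0) := by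
  rw [← sum_smul_eV]
  simp [eSet]

lemma epsB_eq_mk : epsB D C = Submodule.Quotient.mk (fun i => triParity (gB D C i)) :=
  sum_smul_eV _

lemma epsB_mem_spanB_iff : epsB D C ∈ spanB D B ↔
    ∃ (c : Finset (ZMod (D + 1)) → ZMod 2) (a : ZMod 2),
      ∀ i, triParity (gB D C i) = ∑ I ∈ through D B i, c I + a := by
  rw [spanB, Submodule.mem_span_image_finset_iff_exists_fun']
  refine exists_congr fun c => ?_
  have h : ∑ I ∈ B, c I • eSet D I =
      Submodule.Quotient.mk (fun i => ∑ I ∈ through D B i, c I) := by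
    simp only [eSet_eq_mk, ← Submodule.mkQ_apply, ← map_smul, ← map_sum]
    congr 1
    funext i
    simp [through, Finset.sum_filter]
  rw [h, epsB_eq_mk, eq_comm, Submodule.Quotient.eq, Submodule.mem_span_singleton]
  refine exists_congr fun a => ?_
  rw [funext_iff]
  refine forall_congr' fun i => ?_
  simp only [allOnes, Pi.smul_apply, Pi.sub_apply, smul_eq_mul, mul_one]
  rw [eq_sub_iff_add_eq, eq_comm, add_comm]

lemma phi.epsB_mem_spanB (hD : Even D) (hB : phi D B) : epsB D B ∈ spanB D B := by
  set y : ZMod (D + 1) → ZMod 2 := fun i => ∑ I ∈ through D B i, (depth D B I : ZMod 2) with hy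
  have hstep : ∀ p, triParity (gB D B p) - y p = triParity (gB D B (p - 1)) - y (p - 1) := by
    intro p
    simp only [hy]
    rcases hB.trichotomy hD p with ⟨I, -, h, h', hd⟩ | ⟨I, -, h, h', hd⟩ | ⟨h, h'⟩
    · have hcard : gB D B p = gB D B (p - 1) + 1 := by
        rw [← card_through, h', Finset.card_insert_of_notMem h, card_through]
      rw [h', Finset.sum_insert h, hd, hcard, triParity_succ]
      ring
    · have hcard : gB D B (p - 1) = gB D B p + 1 := by
        rw [← card_through, h', Finset.card_insert_of_notMem h, card_through]
      rw [h', Finset.sum_insert h, hd, hcard, triParity_succ]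
      ring
    · simp [← card_through, h, h']
  have hconst : ∀ t : ℕ, triParity (gB D B (t : ZMod (D + 1))) - y t =
      triParity (gB D B 0) - y 0 := by
    intro t
    induction t with
    | zero => simp
    | succ t ih => rw [hstep]; simpa using ih
  refine epsB_mem_spanB_iff.2 ⟨fun I => depth D B I, triParity (gB D B 0) - y 0, fun i => ?_⟩
  have := hconst i.val
  rw [ZMod.natCast_zmod_val] at this
  rw [← this, hy]
  ring

/-- The matrix `(C, B) ↦ [ε(C) ∈ ⟨B⟩]` is triangular for the pointwise order on `g`. -/
lemma gB_le_of_epsB_mem_spanB (hD : Even D) (hB : phi D B) (hC : phi D C)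
    (h : epsB D C ∈ spanB D B) : gB D C ≤ gB D B := by
  obtain ⟨c, a, hca⟩ := epsB_mem_spanB_iff.1 h
  have hR : (fun i => (-1) ^ gB D C i * (1 + 2 * (gB D C i : ℤ))) =
      fun i => (-1) ^ gB D B i * (1 + 2 * signedCount D B c i) := by
    refine eq_of_add_shift_eq hD fun p => ?_
    rw [hC.signChar_triParity_gB hD, hB.signChar_signedCount hD, hca, hca, add_add_add_comm,
      CharTwo.add_self_eq_zero, add_zero]
  intro i
  have h1 := congrArg abs (congrFun hR i)
  simp only [abs_mul, abs_pow, abs_neg, abs_one, one_pow, one_mul] at h1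
  have h2 := abs_signedCount_le (B := B) c i
  rw [abs_le] at h2
  have h3 : |1 + 2 * signedCount D B c i| ≤ 1 + 2 * (gB D B i : ℤ) := by
    rw [abs_le]
    constructor <;> linarith
  have h4 := le_abs_self (1 + 2 * (gB D C i : ℤ))
  change gB D C i ≤ gB D B i
  omega

end Span

/-- Theorem 2.4: if `δ_{ε(C)} = ∑_{B ∈ φ(V_D)} r(B)·1_{⟨B⟩}` then `r(B) ≠ 0` implies
`|B| ≤ |C|`. -/
theorem theorem_2_4 (D : ℕ) (hD : 2 ≤ D) (hDev : Even D)
    (C : Finset (Finset (ZMod (D + 1)))) (hC : phi D C)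
    (r : Finset (Finset (ZMod (D + 1))) → ℤ)
    (hr : delta D (epsB D C) =
      ∑ᶠ B ∈ {B | phi D B}, (r B : ℂ) • ind D ↑(spanB D B)) :
    ∀ B, phi D B → r B ≠ 0 → B.card ≤ C.card := by
  classical
  have heval : ∀ x, delta D (epsB D C) x =
      ∑ B ∈ Finset.univ.filter (phi D), (r B : ℂ) * ind D ↑(spanB D B) x := by
    intro x
    rw [hr, finsum_mem_eq_finite_toFinset_sum _ (Set.toFinite _), Finset.sum_apply]
    refine Finset.sum_congr (by ext; simp) fun B _ => rfl
  suffices hle : ∀ B, phi D B → r B ≠ 0 → gB D B ≤ gB D C from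
    fun B hB hrB => card_le_of_gB_le hDev hB hC (hle B hB hrB)
  by_contra! hbad
  obtain ⟨B₀, hB₀, hr₀, hle₀⟩ := hbad
  obtain ⟨B, hB, hmax⟩ := Finset.exists_max_image
    (Finset.univ.filter fun B => phi D B ∧ r B ≠ 0 ∧ ¬ gB D B ≤ gB D C)
    (fun B => ∑ i, gB D B i) ⟨B₀, by simp [hB₀, hr₀, hle₀]⟩
  simp only [Finset.mem_filter, Finset.mem_univ, true_and, and_imp] at hB hmax
  obtain ⟨hB, hrB, hle⟩ := hB
  have hx := heval (epsB D B)
  rw [Finset.sum_eq_single_of_mem B (by simpa using hB)] at hx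
  · have h0 : delta D (epsB D C) (epsB D B) = 0 := by
      refine Set.indicator_of_notMem (fun h => hle ?_) _
      refine gB_le_of_epsB_mem_spanB hDev hC hB ?_
      rw [Set.mem_singleton_iff.1 h]
      exact hC.epsB_mem_spanB hDev
    have h1 : ind D ↑(spanB D B) (epsB D B) = 1 :=
      Set.indicator_of_mem (hB.epsB_mem_spanB hDev) _
    rw [h0, h1, mul_one] at hx
    exact hrB (by exact_mod_cast hx.symm)
  · intro B' hB' hne
    have hB' : phi D B' := by simpa using hB'
    by_cases hmem : epsB D B ∈ spanB D B'
    · have hBB' := gB_le_of_epsB_mem_spanB hDev hB' hB hmem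
      by_cases hr' : r B' = 0
      · simp [hr']
      · have hsum := hmax B' hB' hr' fun h => hle (hBB'.trans h)
        have heq := (Finset.sum_eq_sum_iff_of_le fun i _ => hBB' i).1
          (le_antisymm (Finset.sum_le_sum fun i _ => hBB' i) hsum)
        exact absurd (eq_of_gB_eq hDev hB' hB (funext fun i => (heq i (Finset.mem_univ i)).symm)) hne
    · have : ind D ↑(spanB D B') (epsB D B) = 0 := Set.indicator_of_notMem hmem _
      rw [this, mul_zero]
end
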